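/- (Germ extension) Let E be an open neighborhood of 0 in EuclideanSpace ℝ (Fin q) and let B : E → ((EuclideanSpace ℝ (Fin k)) →ₗ[ℝ] (EuclideanSpace ℝ (Fin q))) be smooth, such that for every y ∈ E the bilinear map (ξ, w) ↦ (fderiv ℝ A y ξ) w is nonsingular, where A y (t, λ) = B y t + λ • y. Then there exist r > 0 with Metric.ball 0 r ⊆ E and a smooth map B̃ : EuclideanSpace ℝ (Fin q) → ((EuclideanSpace ℝ (Fin k)) →ₗ[ℝ] (EuclideanSpace ℝ (Fin q))) agreeing with B on Metric.ball 0 r, such that for every y the bilinear map (ξ, w) ↦ (fderiv ℝ Ã y ξ) w is nonsingular (Ã y (t, λ) = B̃ y t + λ • y), and the associated affine planes P̃_y = {(t, B̃ y t + y) : t} are pairwise skew with union all of ℝ^k × ℝ^q. In words: every germ of a smooth nondegenerate fibration of ℝ^n by k-planes extends to a smooth nondegenerate fibration of all of ℝ^n. -/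

import Mathlib

open Metric Module Filter

/-- The affine `k`-plane `P_y = {(t, B y t + y) : t}` associated to a map
`B` into the space of linear maps. -/
noncomputable def plane {q k : ℕ}
    (B : EuclideanSpace ℝ (Fin q) → (EuclideanSpace ℝ (Fin k) →ₗ[ℝ] EuclideanSpace ℝ (Fin q)))
    (y : EuclideanSpace ℝ (Fin q)) :
    AffineSubspace ℝ (EuclideanSpace ℝ (Fin k) × EuclideanSpace ℝ (Fin q)) :=
  AffineSubspace.mk' (0, y) (LinearMap.graph (B y))

/-- The linear map `A y : (t, λ) ↦ B y t + λ • y`, as a continuous linear map. -/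
noncomputable def Amap {q k : ℕ}
    (B : EuclideanSpace ℝ (Fin q) → (EuclideanSpace ℝ (Fin k) →ₗ[ℝ] EuclideanSpace ℝ (Fin q)))
    (y : EuclideanSpace ℝ (Fin q)) :
    (EuclideanSpace ℝ (Fin k) × ℝ) →L[ℝ] EuclideanSpace ℝ (Fin q) :=
  LinearMap.toContinuousLinearMap
    ((B y).comp (LinearMap.fst ℝ (EuclideanSpace ℝ (Fin k)) ℝ) +
      (LinearMap.snd ℝ (EuclideanSpace ℝ (Fin k)) ℝ).smulRight y)

/-- A bilinear family without zeros is bounded below. -/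
theorem exists_pos_bound_of_nonsingular {V W Z : Type*}
    [NormedAddCommGroup V] [NormedSpace ℝ V] [FiniteDimensional ℝ V]
    [NormedAddCommGroup W] [NormedSpace ℝ W] [FiniteDimensional ℝ W]
    [NormedAddCommGroup Z] [NormedSpace ℝ Z] (D : V →L[ℝ] W →L[ℝ] Z)
    (hD : ∀ ξ w, D ξ w = 0 → ξ = 0 ∨ w = 0) :
    ∃ c > (0 : ℝ), ∀ ξ w, c * (‖ξ‖ * ‖w‖) ≤ ‖D ξ w‖ := by
  have hcpt : IsCompact (sphere (0 : V) 1 ×ˢ sphere (0 : W) 1) :=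
    (isCompact_sphere 0 1).prod (isCompact_sphere 0 1)
  have hcont : ContinuousOn (fun p : V × W => ‖D p.1 p.2‖)
      (sphere (0 : V) 1 ×ˢ sphere (0 : W) 1) := by fun_prop
  obtain ⟨c, hc, hle⟩ := hcpt.exists_forall_le' hcont (a := 0) (by
    rintro ⟨ξ, w⟩ ⟨hξ, hw⟩
    refine norm_pos_iff.2 fun h => ?_
    rcases hD ξ w h with rfl | rfl
    · simp at hξ
    · simp at hw)
  refine ⟨c, hc, fun ξ w => ?_⟩
  rcases eq_or_ne ξ 0 with rfl | hξ
  · simp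
  rcases eq_or_ne w 0 with rfl | hw
  · simp
  have hξ' : 0 < ‖ξ‖ := norm_pos_iff.2 hξ
  have hw' : 0 < ‖w‖ := norm_pos_iff.2 hw
  have h := hle (‖ξ‖⁻¹ • ξ, ‖w‖⁻¹ • w) ⟨by simp [norm_smul, hξ'.ne'], by simp [norm_smul, hw'.ne']⟩
  simp only [map_smul, smul_apply, norm_smul, norm_inv, norm_norm] at h
  calc c * (‖ξ‖ * ‖w‖) ≤ (‖w‖⁻¹ * (‖ξ‖⁻¹ * ‖D ξ w‖)) * (‖ξ‖ * ‖w‖) := by gcongr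
    _ = ‖D ξ w‖ := by field_simp

/-- The germ at `0` of a smooth map vanishing to first order has a global smooth representative
with arbitrarily small derivative. -/
theorem exists_contDiff_eqOn_ball_norm_fderiv_le {V F : Type*}
    [NormedAddCommGroup V] [NormedSpace ℝ V] [FiniteDimensional ℝ V]
    [NormedAddCommGroup F] [NormedSpace ℝ F] {R : V → F} {E : Set V} (hE : IsOpen E)
    (h0E : (0 : V) ∈ E) (hR : ContDiffOn ℝ (⊤ : ℕ∞) R E) (hR0 : R 0 = 0)
    (hR0' : fderiv ℝ R 0 = 0) {δ : ℝ} (hδ : 0 < δ) :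
    ∃ r > (0 : ℝ), ball (0 : V) r ⊆ E ∧ ∃ g : V → F, ContDiff ℝ (⊤ : ℕ∞) g ∧
      Set.EqOn g R (ball 0 r) ∧ ∀ y, ‖fderiv ℝ g y‖ ≤ δ := by
  let χ : ContDiffBump (0 : V) := ⟨1, 2, one_pos, one_lt_two⟩
  have hχ : ContDiff ℝ (⊤ : ℕ∞) χ := χ.contDiff
  obtain ⟨C, hC⟩ := (χ.hasCompactSupport.fderiv ℝ).exists_bound_of_continuous
    (hχ.continuous_fderiv (by simp))
  have hC0 : 0 ≤ C := (norm_nonneg _).trans (hC 0)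
  let η : ℝ := δ / (1 + 2 * C)
  have hη : 0 < η := by positivity
  have hcont : ContinuousAt (fderiv ℝ R) 0 :=
    (hR.continuousOn_fderiv_of_isOpen hE (by simp)).continuousAt
      (hE.mem_nhds h0E)
  have hnhds : ∀ᶠ y in nhds (0 : V), y ∈ E ∧ ‖fderiv ℝ R y‖ < η :=
    (hE.eventually_mem h0E).and (hcont.norm.eventually_lt_const (by simpa [hR0'] using hη))
  obtain ⟨ρ, hρ, hball⟩ := Metric.eventually_nhds_iff_ball.1 hnhds
  have hdiff : ∀ y ∈ ball (0 : V) ρ, ContDiffAt ℝ (⊤ : ℕ∞) R y := fun y hy =>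
    hR.contDiffAt (hE.mem_nhds (hball y hy).1)
  have hRle : ∀ y ∈ ball (0 : V) ρ, ‖R y‖ ≤ η * ‖y‖ := fun y hy => by
    have := (convex_ball (0 : V) ρ).norm_image_sub_le_of_norm_fderiv_le (𝕜 := ℝ) (f := R) (C := η)
      (fun z hz => (hdiff z hz).differentiableAt (by simp)) (fun z hz => (hball z hz).2.le)
      (mem_ball_self hρ) hy
    simpa [hR0] using this
  let ε : ℝ := ρ / 3
  have hε : 0 < ε := by positivity
  let ψ : V → ℝ := fun y => χ (ε⁻¹ • y)
  have hψ : ContDiff ℝ (⊤ : ℕ∞) ψ := hχ.comp (contDiff_const_smul _)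
  have hψ' : ∀ y, ‖fderiv ℝ ψ y‖ ≤ ε⁻¹ * C := fun y => by
    rw [show fderiv ℝ ψ y = ε⁻¹ • fderiv ℝ χ (ε⁻¹ • y) from fderiv_comp_smul .., norm_smul,
      Real.norm_of_nonneg (by positivity)]
    gcongr
    exact hC _
  have hsupp : tsupport ψ ⊆ closedBall 0 (2 * ε) := by
    refine closure_minimal (fun y hy => ?_) isClosed_closedBall
    have : ε⁻¹ • y ∈ ball (0 : V) 2 := by
      rw [← show Function.support χ = ball (0 : V) 2 from χ.support_eq]
      exact hy
    rw [mem_ball_zero_iff, norm_smul, norm_inv, Real.norm_of_nonneg hε.le,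
      inv_mul_lt_iff₀ hε] at this
    simpa [mul_comm] using this.le
  have hsupp' : tsupport (fun y => ψ y • R y) ⊆ closedBall 0 (2 * ε) :=
    (tsupport_smul_subset_left ψ R).trans hsupp
  have hsub : closedBall (0 : V) (2 * ε) ⊆ ball 0 ρ :=
    closedBall_subset_ball (by simp only [ε]; linarith)
  refine ⟨ε, hε, fun y hy => (hball y (hsub (ball_subset_closedBall
    (ball_subset_ball (by linarith) hy)))).1, fun y => ψ y • R y, ?_, fun y hy => ?_, fun y => ?_⟩
  · refine contDiff_iff_contDiffAt.2 fun y => ?_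
    by_cases hy : y ∈ tsupport fun y => ψ y • R y
    · exact hψ.contDiffAt.smul (hdiff y (hsub (hsupp' hy)))
    · exact contDiffAt_const.congr_of_eventuallyEq (notMem_tsupport_iff_eventuallyEq.1 hy)
  · have : ψ y = 1 := χ.one_of_mem_closedBall (by
      rw [mem_ball_zero_iff] at hy
      rw [mem_closedBall_zero_iff, norm_smul, norm_inv, Real.norm_of_nonneg hε.le,
        inv_mul_le_iff₀ hε]
      simpa [χ] using hy.le)
    simp [this]
  · by_cases hy : y ∈ closedBall (0 : V) (2 * ε)
    · have hyρ := hsub hy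
      have hy2 : ‖y‖ ≤ 2 * ε := by simpa using hy
      rw [fderiv_fun_smul (hψ.differentiable (by simp) y)
        ((hdiff y hyρ).differentiableAt (by simp))]
      have h1 : ‖ψ y • fderiv ℝ R y‖ ≤ 1 * η := by
        rw [norm_smul, Real.norm_of_nonneg χ.nonneg]
        exact mul_le_mul χ.le_one (hball y hyρ).2.le (norm_nonneg _) zero_le_one
      have h2 : ‖(fderiv ℝ ψ y).smulRight (R y)‖ ≤ (ε⁻¹ * C) * (η * (2 * ε)) := by
        rw [ContinuousLinearMap.norm_smulRight_apply]
        have := (hRle y hyρ).trans (mul_le_mul_of_nonneg_left hy2 hη.le)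
        exact mul_le_mul (hψ' y) this (norm_nonneg _) (by positivity)
      calc _ ≤ 1 * η + (ε⁻¹ * C) * (η * (2 * ε)) := norm_add_le_of_le h1 h2
        _ = δ := by simp only [η]; field_simp
    · have : fderiv ℝ (fun y => ψ y • R y) y = 0 := by
        by_contra h
        exact hy (hsupp' (support_fderiv_subset ℝ h))
      simpa [this] using hδ.le

theorem fderiv_Amap_apply {q k : ℕ}
    {B : EuclideanSpace ℝ (Fin q) → (EuclideanSpace ℝ (Fin k) →ₗ[ℝ] EuclideanSpace ℝ (Fin q))}
    {y : EuclideanSpace ℝ (Fin q)}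
    (hB : DifferentiableAt ℝ (fun y => LinearMap.toContinuousLinearMap (B y)) y)
    (ξ : EuclideanSpace ℝ (Fin q)) (w : EuclideanSpace ℝ (Fin k) × ℝ) :
    fderiv ℝ (Amap B) y ξ w =
      fderiv ℝ (fun y => LinearMap.toContinuousLinearMap (B y)) y ξ w.1 + w.2 • ξ := by
  let fst := ContinuousLinearMap.fst ℝ (EuclideanSpace ℝ (Fin k)) ℝ
  let snd := ContinuousLinearMap.snd ℝ (EuclideanSpace ℝ (Fin k)) ℝ
  let Φ : (EuclideanSpace ℝ (Fin k) →L[ℝ] EuclideanSpace ℝ (Fin q)) →L[ℝ]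
      EuclideanSpace ℝ (Fin k) × ℝ →L[ℝ] EuclideanSpace ℝ (Fin q) :=
    ContinuousLinearMap.precomp (EuclideanSpace ℝ (Fin q)) fst
  let Ψ := ContinuousLinearMap.smulRightL ℝ (EuclideanSpace ℝ (Fin k) × ℝ)
    (EuclideanSpace ℝ (Fin q)) snd
  have hA : Amap B = fun y => Φ (LinearMap.toContinuousLinearMap (B y)) + Ψ y := by
    funext y
    exact ContinuousLinearMap.ext fun w => rfl
  have h := (Φ.hasFDerivAt.comp y hB.hasFDerivAt).add (Ψ.hasFDerivAt (x := y))
  rw [hA, HasFDerivAt.fderiv (f := fun y => Φ (LinearMap.toContinuousLinearMap (B y)) + Ψ y) h]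
  rfl

theorem mem_plane_iff {q k : ℕ}
    (B : EuclideanSpace ℝ (Fin q) → (EuclideanSpace ℝ (Fin k) →ₗ[ℝ] EuclideanSpace ℝ (Fin q)))
    (y : EuclideanSpace ℝ (Fin q)) (p : EuclideanSpace ℝ (Fin k) × EuclideanSpace ℝ (Fin q)) :
    p ∈ plane B y ↔ p.2 = B y p.1 + y := by
  simp [plane, AffineSubspace.mem_mk', LinearMap.mem_graph_iff, sub_eq_iff_eq_add]

/-- A small perturbation of a bilinear map bounded below is nonsingular. -/
theorem eq_zero_or_eq_zero_of_norm_le {V K : Type*} [NormedAddCommGroup V] [NormedSpace ℝ V]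
    [NormedAddCommGroup K] [NormedSpace ℝ K] {L : V →L[ℝ] K →L[ℝ] V} {c : ℝ} (hc : 0 < c)
    (hL : ∀ (ξ : V) (w : K × ℝ), c * (‖ξ‖ * ‖w‖) ≤ ‖L ξ w.1 + w.2 • ξ‖)
    {m : K →L[ℝ] V} {ξ : V} (hm : ‖m‖ ≤ c / 2 * ‖ξ‖) {w : K × ℝ}
    (h : (L ξ + m) w.1 + w.2 • ξ = 0) : ξ = 0 ∨ w = 0 := by
  have h1 := hL ξ w
  have h2 : L ξ w.1 + w.2 • ξ = -(m w.1) := by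
    rw [eq_neg_iff_add_eq_zero, ← h, add_apply]
    abel
  have h3 : ‖m w.1‖ ≤ c / 2 * ‖ξ‖ * ‖w‖ :=
    m.le_of_opNorm_le_of_le hm (norm_fst_le w)
  rw [h2, norm_neg] at h1
  have h4 : c * (‖ξ‖ * ‖w‖) ≤ 0 := by nlinarith
  have h5 : ‖ξ‖ * ‖w‖ = 0 :=
    le_antisymm (nonpos_of_mul_nonpos_right h4 hc) (by positivity)
  simpa using h5

/-- If `g` is Lipschitz with a small constant, then `y ↦ L y t + y + g y t` is onto. -/
theorem surjective_of_lipschitzWith {V K : Type*} [NormedAddCommGroup V] [NormedSpace ℝ V]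
    [FiniteDimensional ℝ V] [NormedAddCommGroup K] [NormedSpace ℝ K] {L : V →L[ℝ] K →L[ℝ] V}
    {c : ℝ} (hc : 0 < c)
    (hL : ∀ (ξ : V) (w : K × ℝ), c * (‖ξ‖ * ‖w‖) ≤ ‖L ξ w.1 + w.2 • ξ‖) {g : V → K →L[ℝ] V}
    (hg : ∀ x y, ‖g x - g y‖ ≤ c / 2 * ‖x - y‖) (t : K) :
    Function.Surjective fun y => L y t + y + g y t := by
  have : CompleteSpace V := FiniteDimensional.complete ℝ V
  let f' : V →L[ℝ] V := L.flip t + ContinuousLinearMap.id ℝ V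
  have hlow : ∀ ξ, c * (‖ξ‖ * ‖(t, (1 : ℝ))‖) ≤ ‖f' ξ‖ := fun ξ => by
    simpa [f'] using hL ξ (t, 1)
  have hT : 0 < ‖(t, (1 : ℝ))‖ := norm_pos_iff.2 (by simp)
  have hinj : Function.Injective (f' : V →ₗ[ℝ] V) := by
    refine (injective_iff_map_eq_zero _).2 fun ξ hξ => ?_
    have h := hlow ξ
    rw [show f' ξ = 0 from hξ, norm_zero] at h
    by_contra hne
    have : 0 < ‖ξ‖ := norm_pos_iff.2 hne
    have : 0 < c * (‖ξ‖ * ‖(t, (1 : ℝ))‖) := by positivity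
    linarith
  let e : V ≃L[ℝ] V := (LinearEquiv.ofInjectiveEndo (f' : V →ₗ[ℝ] V) hinj).toContinuousLinearEquiv
  have he : (e : V →L[ℝ] V) = f' := by
    ext ξ
    rfl
  have hsymm : ‖(e.symm : V →L[ℝ] V)‖ ≤ (c * ‖(t, (1 : ℝ))‖)⁻¹ := by
    refine ContinuousLinearMap.opNorm_le_bound _ (by positivity) fun z => ?_
    have h := hlow (e.symm z)
    rw [← he, show (e : V →L[ℝ] V) (e.symm z) = z from e.apply_symm_apply z] at h
    rw [← div_eq_inv_mul, le_div_iff₀ (by positivity)]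
    calc _ = c * (‖e.symm z‖ * ‖(t, (1 : ℝ))‖) := by
          rw [ContinuousLinearEquiv.coe_coe]; ring
      _ ≤ _ := h
  have happrox : ApproximatesLinearOn (fun y => L y t + y + g y t) (e : V →L[ℝ] V) Set.univ
      (c / 2 * ‖t‖).toNNReal := by
    intro x _ y _
    rw [he, Real.coe_toNNReal _ (by positivity)]
    have : L x t + x + g x t - (L y t + y + g y t) - f' (x - y) = (g x - g y) t := by
      simp only [f', add_apply, ContinuousLinearMap.flip_apply,
        ContinuousLinearMap.id_apply, map_sub, sub_apply]
      abel
    rw [this]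
    calc _ ≤ c / 2 * ‖x - y‖ * ‖t‖ := (g x - g y).le_of_opNorm_le (hg x y) t
      _ = _ := by ring
  refine happrox.surjective (e.subsingleton_or_nnnorm_symm_pos.imp_right fun hpos => ?_)
  rw [← NNReal.coe_lt_coe, Real.coe_toNNReal _ (by positivity), NNReal.coe_inv, coe_nnnorm]
  refine lt_of_lt_of_le ?_ (le_inv_of_le_inv₀ (by exact_mod_cast hpos) hsymm)
  have : ‖t‖ ≤ ‖(t, (1 : ℝ))‖ := norm_fst_le (t, (1 : ℝ))
  nlinarith [mul_le_mul_of_nonneg_left this hc.le, mul_pos hc hT]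

theorem germ_of_nondegenerate_fibration_extends (q k : ℕ)
    (E : Set (EuclideanSpace ℝ (Fin q))) (hE : IsOpen E) (h0E : (0 : EuclideanSpace ℝ (Fin q)) ∈ E)
    (B : EuclideanSpace ℝ (Fin q) → (EuclideanSpace ℝ (Fin k) →ₗ[ℝ] EuclideanSpace ℝ (Fin q)))
    (hB : ContDiffOn ℝ (⊤ : ℕ∞) (fun y => LinearMap.toContinuousLinearMap (B y)) E)
    (hnonsing : ∀ y ∈ E, ∀ (ξ : EuclideanSpace ℝ (Fin q)) (w : EuclideanSpace ℝ (Fin k) × ℝ),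
      (fderiv ℝ (Amap B) y) ξ w = 0 → ξ = 0 ∨ w = 0) :
    ∃ r > (0 : ℝ), Metric.ball (0 : EuclideanSpace ℝ (Fin q)) r ⊆ E ∧
      ∃ B' : EuclideanSpace ℝ (Fin q) → (EuclideanSpace ℝ (Fin k) →ₗ[ℝ] EuclideanSpace ℝ (Fin q)),
        ContDiff ℝ (⊤ : ℕ∞) (fun y => LinearMap.toContinuousLinearMap (B' y)) ∧
        (∀ y ∈ Metric.ball (0 : EuclideanSpace ℝ (Fin q)) r, B' y = B y) ∧
        (∀ y : EuclideanSpace ℝ (Fin q),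
          ∀ (ξ : EuclideanSpace ℝ (Fin q)) (w : EuclideanSpace ℝ (Fin k) × ℝ),
            (fderiv ℝ (Amap B') y) ξ w = 0 → ξ = 0 ∨ w = 0) ∧
        (∀ x y : EuclideanSpace ℝ (Fin q), x ≠ y →
          Disjoint (plane B' x : Set (EuclideanSpace ℝ (Fin k) × EuclideanSpace ℝ (Fin q)))
            (plane B' y : Set (EuclideanSpace ℝ (Fin k) × EuclideanSpace ℝ (Fin q))) ∧
          (plane B' x).direction ⊓ (plane B' y).direction = ⊥) ∧
        (∀ p : EuclideanSpace ℝ (Fin k) × EuclideanSpace ℝ (Fin q),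
          ∃ y : EuclideanSpace ℝ (Fin q), p ∈ plane B' y) := by
  let b := fun y => LinearMap.toContinuousLinearMap (B y)
  have hb : ∀ y ∈ E, DifferentiableAt ℝ b y := fun y hy =>
    (hB.contDiffAt (hE.mem_nhds hy)).differentiableAt (by simp)
  obtain ⟨c, hc, hD⟩ := exists_pos_bound_of_nonsingular (fderiv ℝ (Amap B) 0) (hnonsing 0 h0E)
  let L := fderiv ℝ b 0
  have hL : ∀ (ξ : EuclideanSpace ℝ (Fin q)) (w : EuclideanSpace ℝ (Fin k) × ℝ),
      c * (‖ξ‖ * ‖w‖) ≤ ‖L ξ w.1 + w.2 • ξ‖ := fun ξ w =>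
    (hD ξ w).trans_eq (congrArg norm (fderiv_Amap_apply (hb 0 h0E) ξ w))
  have hR0' : fderiv ℝ (fun y => b y - (b 0 + L y)) 0 = 0 := by
    have h := (hb 0 h0E).hasFDerivAt.sub (L.hasFDerivAt.const_add (b 0))
    rw [HasFDerivAt.fderiv (f := fun y => b y - (b 0 + L y)) h, sub_self]
  obtain ⟨r, hr, hrE, g, hg, hgR, hg'⟩ := exists_contDiff_eqOn_ball_norm_fderiv_le hE h0E
    (hB.sub (contDiff_const.add L.contDiff).contDiffOn) (by simp [b]) hR0' (half_pos hc)
  have hlip : ∀ x y, ‖g x - g y‖ ≤ c / 2 * ‖x - y‖ := fun x y =>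
    convex_univ.norm_image_sub_le_of_norm_fderiv_le (𝕜 := ℝ)
      (fun z _ => hg.differentiable (by simp) z) (fun z _ => hg' z) (Set.mem_univ y)
      (Set.mem_univ x)
  let b' := fun y => b 0 + L y + g y
  have hb' : ContDiff ℝ (⊤ : ℕ∞) b' := (contDiff_const.add L.contDiff).add hg
  let B' := fun y => (b' y : EuclideanSpace ℝ (Fin k) →ₗ[ℝ] EuclideanSpace ℝ (Fin q))
  have hfb' : ∀ y, fderiv ℝ b' y = L + fderiv ℝ g y := fun y =>
    ((L.hasFDerivAt.const_add (b 0)).add (hg.differentiable (by simp) y).hasFDerivAt).fderiv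
  have hsub : ∀ x y, b' x - b' y = L (x - y) + (g x - g y) := fun x y => by
    simp only [b', map_sub]
    abel
  have hskew : ∀ x y, x ≠ y → ∀ w : EuclideanSpace ℝ (Fin k) × ℝ,
      (b' x - b' y) w.1 + w.2 • (x - y) = 0 → w = 0 := fun x y hxy w h =>
    (eq_zero_or_eq_zero_of_norm_le hc hL (hlip x y) (hsub x y ▸ h)).resolve_left
      (sub_ne_zero.2 hxy)
  refine ⟨r, hr, hrE, B', hb', fun y hy => ?_, fun y ξ w h => ?_,
    fun x y hxy => ⟨?_, ?_⟩, fun p => ?_⟩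
  · have : b' y = b y := by
      simp only [b', hgR hy]
      abel
    exact congrArg (fun f : EuclideanSpace ℝ (Fin k) →L[ℝ] EuclideanSpace ℝ (Fin q) =>
      (f : EuclideanSpace ℝ (Fin k) →ₗ[ℝ] EuclideanSpace ℝ (Fin q))) this
  · rw [fderiv_Amap_apply (B := B') (hb'.differentiable (by simp) y)] at h
    refine eq_zero_or_eq_zero_of_norm_le hc hL (m := fderiv ℝ g y ξ)
      ((fderiv ℝ g y).le_of_opNorm_le (hg' y) ξ) ?_
    rw [← add_apply, ← hfb' y]
    exact h
  · refine Set.disjoint_left.2 fun p hx hy => ?_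
    rw [SetLike.mem_coe, mem_plane_iff] at hx hy
    have h := hskew x y hxy (p.1, 1) (by
      rw [sub_apply, one_smul, ← sub_eq_zero.2 (hx.symm.trans hy)]
      simp only [B', ContinuousLinearMap.coe_coe]
      abel)
    simpa using congrArg Prod.snd h
  · refine (Submodule.eq_bot_iff _).2 fun p hp => ?_
    rw [Submodule.mem_inf, plane, plane, AffineSubspace.direction_mk',
      AffineSubspace.direction_mk', LinearMap.mem_graph_iff, LinearMap.mem_graph_iff] at hp
    have h := hskew x y hxy (p.1, 0) (by
      rw [zero_smul, add_zero, sub_apply]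
      exact sub_eq_zero.2 (hp.1.symm.trans hp.2))
    have h1 : p.1 = 0 := congrArg Prod.fst h
    exact Prod.ext h1 (by rw [hp.1, h1, map_zero]; rfl)
  · obtain ⟨y, hy⟩ := surjective_of_lipschitzWith hc hL hlip p.1 (p.2 - b 0 p.1)
    refine ⟨y, (mem_plane_iff _ _ _).2 ?_⟩
    rw [← sub_add_cancel p.2 (b 0 p.1), ← hy]
    simp only [B', b', ContinuousLinearMap.coe_coe, add_apply]
    abel
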